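/- arXiv:1505.06708 — 3 statements merged into one kernel-verified Lean document; each statement's English description precedes it below -/
import Mathlib

section
/- Let n ≥ 0 and a ≥ 1 be integers and let c, c1, c2 ∈ {+1, −1}. Then F_{n,a}(c1, c2) = c holds if and only if one of the following is true: (n, a) = (0, 1) and (c1, c2) = (−c, −c); or (n, a) = (0, 2) and (c1, c2) = (c, c); or a = 1 and (c1, c2) = (−c, c) (for an arbitrary n ≥ 0). -/
noncomputable section

/-- The polynomial `f_n(X) = X³ − (n−1)X² − (n+2)X − 1`. -/
def fn (n : ℤ) (X : ℝ) : ℝ := X ^ 3 - ((n : ℝ) - 1) * X ^ 2 - ((n : ℝ) + 2) * X - 1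

/-- `l0, l1, l2` are the three distinct real roots of `f_n`. -/
def IsRoots (n : ℤ) (l0 l1 l2 : ℝ) : Prop :=
  fn n l0 = 0 ∧ fn n l1 = 0 ∧ fn n l2 = 0 ∧ l0 ≠ l1 ∧ l0 ≠ l2 ∧ l1 ≠ l2

/-- The form `F_{n,a}(x,y) = ∏ (x − λᵃ y)` over the three roots `λ` of `f_n`. -/
def Fna (a : ℤ) (l0 l1 l2 x y : ℝ) : ℝ :=
  (x - l0 ^ a * y) * (x - l1 ^ a * y) * (x - l2 ^ a * y)

/-- Three distinct roots of `f_n` give its factorization. -/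
theorem IsRoots.fn_eq {n : ℤ} {l0 l1 l2 : ℝ} (h : IsRoots n l0 l1 l2) (x : ℝ) :
    fn n x = (x - l0) * (x - l1) * (x - l2) := by
  obtain ⟨h0, h1, h2, h01, h02, h12⟩ := h
  unfold fn at *
  have d01 : l0 ^ 2 + l0 * l1 + l1 ^ 2 - ((n : ℝ) - 1) * (l0 + l1) - ((n : ℝ) + 2) = 0 :=
    mul_left_cancel₀ (sub_ne_zero.mpr h01) (by linear_combination h0 - h1)
  have d02 : l0 ^ 2 + l0 * l2 + l2 ^ 2 - ((n : ℝ) - 1) * (l0 + l2) - ((n : ℝ) + 2) = 0 :=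
    mul_left_cancel₀ (sub_ne_zero.mpr h02) (by linear_combination h0 - h2)
  have e1 : l0 + l1 + l2 - ((n : ℝ) - 1) = 0 :=
    mul_left_cancel₀ (sub_ne_zero.mpr h12) (by linear_combination d01 - d02)
  linear_combination h0 + (x - l0) * d01 + (x - l0) * (x - l1) * e1

/-- On `[0, 6/5]` the polynomial `f_n` is negative, so it has no root there. -/
theorem neg_or_gt_of_fn_eq_zero {n : ℤ} (hn : 0 ≤ n) {x : ℝ} (hx : fn n x = 0) :
    x < 0 ∨ 6 / 5 < x := by
  have hn' : (0 : ℝ) ≤ n := by exact_mod_cast hn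
  by_contra! h
  obtain ⟨h0, h1⟩ := h
  unfold fn at hx
  nlinarith [mul_nonneg hn' h0, mul_nonneg hn' (sq_nonneg x), mul_nonneg h0 (sub_nonneg.mpr h1),
    mul_nonneg (mul_nonneg h0 h0) (sub_nonneg.mpr h1)]

theorem ne_neg_one_of_fn_eq_zero {n : ℤ} {x : ℝ} (hx : fn n x = 0) : x ≠ -1 := by
  rintro rfl
  unfold fn at hx
  linarith

theorem abs_one_sub_lt_abs_one_sub_pow {x : ℝ} (h0 : 0 < x) (h1 : x ≠ 1) {m : ℕ} (hm : 2 ≤ m) :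
    |1 - x| < |1 - x ^ m| := by
  rcases lt_or_gt_of_ne h1 with h | h
  · have hp : x ^ m < x := pow_lt_self_of_lt_one₀ h0 h hm
    rw [abs_of_pos (by linarith), abs_of_pos (by linarith)]
    linarith
  · have hp : x < x ^ m := lt_self_pow₀ h hm
    rw [abs_of_neg (by linarith), abs_of_neg (by linarith)]
    linarith

theorem abs_mul_three_lt {x y z x' y' z' : ℝ} (hx : |x| < |x'|) (hy : |y| < |y'|)
    (hz : |z| < |z'|) : |x * y * z| < |x' * y' * z'| := by
  simp only [abs_mul]
  have hxy := mul_lt_mul'' hx hy (abs_nonneg _) (abs_nonneg _)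
  exact mul_lt_mul'' hxy hz (by positivity) (abs_nonneg _)

theorem IsRoots.prod_one_sub {n : ℤ} {l0 l1 l2 : ℝ} (h : IsRoots n l0 l1 l2) :
    (1 - l0) * (1 - l1) * (1 - l2) = -(2 * n + 1) := by
  rw [← h.fn_eq]; unfold fn; ring

theorem IsRoots.prod_one_add {n : ℤ} {l0 l1 l2 : ℝ} (h : IsRoots n l0 l1 l2) :
    (1 + l0) * (1 + l1) * (1 + l2) = -1 := by
  have := h.fn_eq (-1)
  unfold fn at this
  linear_combination this

theorem IsRoots.prod_eq_one {n : ℤ} {l0 l1 l2 : ℝ} (h : IsRoots n l0 l1 l2) :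
    l0 * l1 * l2 = 1 := by
  have := h.fn_eq 0
  unfold fn at this
  linear_combination this

/-- `∏ (1 - λ²) = 2n + 1`. -/
theorem IsRoots.prod_one_sub_sq {n : ℤ} {l0 l1 l2 : ℝ} (h : IsRoots n l0 l1 l2) :
    (1 - l0 ^ 2) * (1 - l1 ^ 2) * (1 - l2 ^ 2) = 2 * n + 1 := by
  linear_combination (1 + l0) * (1 + l1) * (1 + l2) * h.prod_one_sub
    - (2 * (n : ℝ) + 1) * h.prod_one_add

theorem one_lt_prod_one_add_even {l0 l1 l2 : ℝ} (h0 : l0 ≠ 0) (h1 : l1 ≠ 0) (h2 : l2 ≠ 0)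
    {k : ℕ} (hk : Even k) : 1 < (1 + l0 ^ k) * (1 + l1 ^ k) * (1 + l2 ^ k) := by
  have p0 := hk.pow_pos h0
  have p1 := hk.pow_pos h1
  have p2 := hk.pow_pos h2
  have := mul_pos p0 p1
  have := mul_pos (mul_pos p0 p1) p2
  nlinarith [mul_pos p0 p2, mul_pos p1 p2]

theorem abs_one_add_lt_of_odd {x : ℝ} (hx : x < 0 ∨ 6 / 5 < x) (h1 : x ≠ -1) {k : ℕ}
    (hk : Odd k) (hk2 : 2 ≤ k) : |1 + x| < |1 + x ^ k| := by
  rcases hx with h | h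
  · have := abs_one_sub_lt_abs_one_sub_pow (x := -x) (by linarith)
      (fun e => h1 (by linarith)) hk2
    simpa [hk.neg_pow] using this
  · have hp : x < x ^ k := lt_self_pow₀ (by linarith) hk2
    rw [abs_of_pos (by linarith), abs_of_pos (by linarith)]
    linarith

theorem prod_one_sub_odd_lt {l0 l1 l2 : ℝ} (h0 : 6 / 5 < l0) (h1 : l1 < 0) (h2 : l2 < 0)
    (h : l0 * l1 * l2 = 1) {k : ℕ} (hk : Odd k) (hk3 : 3 ≤ k) :
    (1 - l0 ^ k) * (1 - l1 ^ k) * (1 - l2 ^ k) < -1 := by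
  have p0 : (216 / 125 : ℝ) < l0 ^ k := by
    have : l0 ^ 3 ≤ l0 ^ k := pow_le_pow_right₀ (by linarith) hk3
    have : (6 / 5 : ℝ) ^ 3 < l0 ^ 3 := by gcongr
    norm_num at this
    linarith
  have p1 := hk.pow_neg h1
  have p2 := hk.pow_neg h2
  have hp : l0 ^ k * l1 ^ k * l2 ^ k = 1 := by rw [← mul_pow, ← mul_pow, h, one_pow]
  have hpq := mul_pos_of_neg_of_neg p1 p2
  generalize l0 ^ k = L at *
  generalize l1 ^ k = P at *
  generalize l2 ^ k = Q at *
  have hlt : P * Q < 125 / 216 := by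
    by_contra! hge
    nlinarith [mul_pos (sub_pos.mpr p0) hpq]
  nlinarith [mul_pos (by linarith : 0 < L - 1) (by linarith : 0 < -P),
    mul_pos (by linarith : 0 < L - 1) (by linarith : 0 < -Q)]

theorem IsRoots.prod_one_sub_odd_lt {n : ℤ} (hn : 0 ≤ n) {l0 l1 l2 : ℝ}
    (h : IsRoots n l0 l1 l2) {k : ℕ} (hk : Odd k) (hk3 : 3 ≤ k) :
    (1 - l0 ^ k) * (1 - l1 ^ k) * (1 - l2 ^ k) < -1 := by
  have hp := h.prod_eq_one
  have hadd := h.prod_one_add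
  have r0 := neg_or_gt_of_fn_eq_zero hn h.1
  have r1 := neg_or_gt_of_fn_eq_zero hn h.2.1
  have r2 := neg_or_gt_of_fn_eq_zero hn h.2.2.1
  have neg_of_two : ∀ x y z : ℝ, 0 < x → 0 < y → x * y * z = 1 →
      (1 + x) * (1 + y) * (1 + z) = -1 → False := by
    intro x y z hx hy hxyz hsum
    have hz : 0 < z := pos_of_mul_pos_right (hxyz ▸ one_pos) (mul_pos hx hy).le
    have : 0 < (1 + x) * (1 + y) * (1 + z) := by positivity
    linarith
  rcases r0 with r0 | r0 <;> rcases r1 with r1 | r1 <;> rcases r2 with r2 | r2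
  · nlinarith [mul_pos_of_neg_of_neg r0 r1]
  · have := _root_.prod_one_sub_odd_lt r2 r0 r1 (by linarith) hk hk3
    linarith
  · have := _root_.prod_one_sub_odd_lt r1 r0 r2 (by linarith) hk hk3
    linarith
  · exact (neg_of_two l1 l2 l0 (by linarith) (by linarith) (by linarith) (by linarith)).elim
  · exact _root_.prod_one_sub_odd_lt r0 r1 r2 hp hk hk3
  · exact (neg_of_two l0 l2 l1 (by linarith) (by linarith) (by linarith) (by linarith)).elim
  · exact (neg_of_two l0 l1 l2 (by linarith) (by linarith) hp hadd).elim
  · exact (neg_of_two l0 l1 l2 (by linarith) (by linarith) hp hadd).elim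

/-- For exponents at least `3` the norm of `1 - λᵏ` is never a unit. -/
theorem IsRoots.one_lt_abs_prod_one_sub_pow {n : ℤ} (hn : 0 ≤ n) {l0 l1 l2 : ℝ}
    (h : IsRoots n l0 l1 l2) {k : ℕ} (hk : 3 ≤ k) :
    1 < |(1 - l0 ^ k) * (1 - l1 ^ k) * (1 - l2 ^ k)| := by
  rcases Nat.even_or_odd k with he | ho
  · obtain ⟨m, rfl⟩ := he.exists_two_nsmul
    have hm : 2 ≤ m := by simp only [smul_eq_mul] at hk; omega
    have hn' : (0 : ℝ) ≤ n := by exact_mod_cast hn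
    have key : ∀ x : ℝ, fn n x = 0 → |1 - x ^ 2| < |1 - (x ^ 2) ^ m| := by
      intro x hx
      have r := neg_or_gt_of_fn_eq_zero hn hx
      have hx0 : x ≠ 0 := by rintro rfl; norm_num at r
      refine abs_one_sub_lt_abs_one_sub_pow (by positivity) (fun e => ?_) hm
      rcases eq_or_eq_neg_of_sq_eq_sq x 1 (by rw [e, one_pow]) with rfl | rfl
      · norm_num at r
      · exact ne_neg_one_of_fn_eq_zero hx rfl
    have hlt := abs_mul_three_lt (key l0 h.1) (key l1 h.2.1) (key l2 h.2.2.1)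
    rw [h.prod_one_sub_sq, abs_of_pos (by linarith)] at hlt
    simp only [smul_eq_mul, pow_mul]
    linarith
  · rw [lt_abs]
    right
    linarith [h.prod_one_sub_odd_lt hn ho hk]

/-- For exponents at least `2` the norm of `1 + λᵏ` is never a unit. -/
theorem IsRoots.one_lt_abs_prod_one_add_pow {n : ℤ} (hn : 0 ≤ n) {l0 l1 l2 : ℝ}
    (h : IsRoots n l0 l1 l2) {k : ℕ} (hk : 2 ≤ k) :
    1 < |(1 + l0 ^ k) * (1 + l1 ^ k) * (1 + l2 ^ k)| := by
  rcases Nat.even_or_odd k with he | ho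
  · have hne : l0 * l1 * l2 ≠ 0 := by rw [h.prod_eq_one]; exact one_ne_zero
    simp only [mul_ne_zero_iff] at hne
    exact (one_lt_prod_one_add_even hne.1.1 hne.1.2 hne.2 he).trans_le (le_abs_self _)
  · have key : ∀ x : ℝ, fn n x = 0 → |1 + x| < |1 + x ^ k| := fun x hx =>
      abs_one_add_lt_of_odd (neg_or_gt_of_fn_eq_zero hn hx) (ne_neg_one_of_fn_eq_zero hx) ho hk
    have hlt := abs_mul_three_lt (key l0 h.1) (key l1 h.2.1) (key l2 h.2.2.1)
    rwa [h.prod_one_add, abs_neg, abs_one] at hlt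

theorem IsRoots.prod_one_sub_pow_eq_iff {n : ℤ} (hn : 0 ≤ n) {l0 l1 l2 : ℝ}
    (h : IsRoots n l0 l1 l2) {k : ℕ} (hk : 1 ≤ k) {d : ℤ} (hd : d = 1 ∨ d = -1) :
    (1 - l0 ^ k) * (1 - l1 ^ k) * (1 - l2 ^ k) = d ↔
      n = 0 ∧ (k = 1 ∧ d = -1 ∨ k = 2 ∧ d = 1) := by
  obtain rfl | rfl | hk3 : k = 1 ∨ k = 2 ∨ 3 ≤ k := by omega
  · rw [pow_one, pow_one, pow_one, h.prod_one_sub]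
    norm_cast
    omega
  · rw [h.prod_one_sub_sq]
    norm_cast
    omega
  · refine iff_of_false (fun e => ?_) (by omega)
    have := h.one_lt_abs_prod_one_sub_pow hn hk3
    rw [e] at this
    rcases hd with rfl | rfl <;> norm_num at this

theorem IsRoots.prod_one_add_pow_eq_iff {n : ℤ} (hn : 0 ≤ n) {l0 l1 l2 : ℝ}
    (h : IsRoots n l0 l1 l2) {k : ℕ} (hk : 1 ≤ k) {d : ℤ} (hd : d = 1 ∨ d = -1) :
    (1 + l0 ^ k) * (1 + l1 ^ k) * (1 + l2 ^ k) = d ↔ k = 1 ∧ d = -1 := by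
  obtain rfl | hk2 : k = 1 ∨ 2 ≤ k := by omega
  · rw [pow_one, pow_one, pow_one, h.prod_one_add]
    norm_cast
    omega
  · refine iff_of_false (fun e => ?_) (by omega)
    have := h.one_lt_abs_prod_one_add_pow hn hk2
    rw [e] at this
    rcases hd with rfl | rfl <;> norm_num at this

theorem stmt16 (n a : ℤ) (hn : 0 ≤ n) (ha : 1 ≤ a) (c c1 c2 : ℤ)
    (hc : c = 1 ∨ c = -1) (hc1 : c1 = 1 ∨ c1 = -1) (hc2 : c2 = 1 ∨ c2 = -1)
    (l0 l1 l2 : ℝ) (hroots : IsRoots n l0 l1 l2) :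
    Fna a l0 l1 l2 (c1 : ℝ) (c2 : ℝ) = (c : ℝ) ↔
      (n = 0 ∧ a = 1 ∧ c1 = -c ∧ c2 = -c) ∨
      (n = 0 ∧ a = 2 ∧ c1 = c ∧ c2 = c) ∨
      (a = 1 ∧ c1 = -c ∧ c2 = c) := by
  lift a to ℕ using by omega
  have hk : 1 ≤ a := by omega
  simp only [Fna, zpow_natCast]
  have hsq : (c1 : ℝ) * c1 = 1 := by rcases hc1 with rfl | rfl <;> norm_num
  have hd : c1 * c = 1 ∨ c1 * c = -1 := by
    rcases hc1 with rfl | rfl <;> rcases hc with rfl | rfl <;> norm_num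
  obtain rfl | rfl : c2 = c1 ∨ c2 = -c1 := by omega
  · have : (c2 - l0 ^ a * c2) * (c2 - l1 ^ a * c2) * (c2 - l2 ^ a * c2) = (c : ℝ) ↔
        (1 - l0 ^ a) * (1 - l1 ^ a) * (1 - l2 ^ a) = ((c2 * c : ℤ) : ℝ) := by
      push_cast
      rcases hc1 with rfl | rfl
      · norm_num
      · norm_num
        constructor <;> intro e <;> linarith
    rw [this, hroots.prod_one_sub_pow_eq_iff hn hk hd]
    rcases hc1 with rfl | rfl <;> rcases hc with rfl | rfl <;> omega
  · have : (c1 - l0 ^ a * (-c1 : ℤ)) * (c1 - l1 ^ a * (-c1 : ℤ)) * (c1 - l2 ^ a * (-c1 : ℤ))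
          = (c : ℝ) ↔
        (1 + l0 ^ a) * (1 + l1 ^ a) * (1 + l2 ^ a) = ((c1 * c : ℤ) : ℝ) := by
      push_cast
      rcases hc1 with rfl | rfl
      · norm_num
      · norm_num
        constructor <;> intro e <;> linarith
    rw [this, hroots.prod_one_add_pow_eq_iff hn hk hd]
    rcases hc1 with rfl | rfl <;> rcases hc with rfl | rfl <;> omega
end
end

section
/- Let x be an integer and c ∈ {+1, −1}. Then: (a) for all integers n ≥ 1 and a ≥ 2, |F_{n,a}(x, c·x)| ≥ (|x|³/8)·a·n^{a−1}; (b) for every integer n ≥ 0, F_{n,1}(x, x) = −(2n+1)·x³; (c) for n = 0 and every integer a ≥ 3, |F_{0,a}(x, c·x)| ≥ |x|³·2^{a−1}. -/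
noncomputable section

theorem IsRoots.fn_eq_prod {n : ℤ} {l0 l1 l2 : ℝ} (h : IsRoots n l0 l1 l2) (X : ℝ) :
    fn n X = (X - l0) * (X - l1) * (X - l2) := by
  obtain ⟨h0, h1, h2, h01, h02, h12⟩ := h
  unfold fn at *
  have e1 : l0 ^ 2 + l0 * l1 + l1 ^ 2 - ((n : ℝ) - 1) * (l0 + l1) - (n + 2) = 0 :=
    mul_left_cancel₀ (sub_ne_zero.2 h01) (by linear_combination h0 - h1)
  have e2 : l0 ^ 2 + l0 * l2 + l2 ^ 2 - ((n : ℝ) - 1) * (l0 + l2) - (n + 2) = 0 :=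
    mul_left_cancel₀ (sub_ne_zero.2 h02) (by linear_combination h0 - h2)
  have e3 : l0 + l1 + l2 - ((n : ℝ) - 1) = 0 :=
    mul_left_cancel₀ (sub_ne_zero.2 h12) (by linear_combination e1 - e2)
  linear_combination (X - l0) * (X - l1) * e3 + (X - l0) * e1 + h0

theorem IsRoots.exists_gt {n : ℤ} {l0 l1 l2 M : ℝ} (h : IsRoots n l0 l1 l2) (hM : fn n M < 0) :
    M < l0 ∨ M < l1 ∨ M < l2 := by
  by_contra! H
  rw [h.fn_eq_prod] at hM
  have := mul_nonneg (mul_nonneg (sub_nonneg.2 H.1) (sub_nonneg.2 H.2.1)) (sub_nonneg.2 H.2.2)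
  linarith

/-- The Galois action `λ ↦ -1 / (1 + λ)` expresses the other two roots through a positive root. -/
theorem fn_eq_zero_cases {n : ℤ} {p l : ℝ} (hp : 0 < p) (h : fn n p = 0) (hl : fn n l = 0)
    (hne : p ≠ l) : l = -(1 + 1 / p) ∨ l = -(1 / (1 + p)) := by
  have key : (l - p) * ((l + (1 + 1 / p)) * (l + 1 / (1 + p))) = 0 := by
    unfold fn at *
    field_simp
    linear_combination (p * (1 + p)) * hl - l * (1 + l) * h
  rcases mul_eq_zero.1 key with h | h
  · exact absurd (by linarith) hne
  · rcases mul_eq_zero.1 h with h | h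
    · left; linarith
    · right; linarith

/-- Lower bound for the form at `(x, ±x)` by absolute values of the roots, in terms of a positive
root `p`. -/
theorem IsRoots.le_abs_Fna {n : ℤ} {l0 l1 l2 M : ℝ} (h : IsRoots n l0 l1 l2) (hM : fn n M < 0)
    (hM1 : 1 ≤ M) {x c : ℤ} (hc : c = 1 ∨ c = -1) (k : ℕ) :
    ∃ p : ℝ, M < p ∧ fn n p = 0 ∧
      |(x : ℝ)| ^ 3 * ((p ^ k - 1) * ((1 + 1 / p) ^ k - 1) * (1 - (1 / (1 + p)) ^ k)) ≤
        |Fna k l0 l1 l2 x ((c * x : ℤ) : ℝ)| := by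
  wlog hl : M < l0 generalizing l0 l1 l2
  · obtain ⟨h0, h1, h2, h01, h02, h12⟩ := h
    rcases IsRoots.exists_gt ⟨h0, h1, h2, h01, h02, h12⟩ hM with H | H | H
    · exact absurd H hl
    · obtain ⟨p, hp, hf, hb⟩ := this ⟨h1, h0, h2, h01.symm, h12, h02⟩ H
      exact ⟨p, hp, hf, hb.trans_eq (by unfold Fna; congr 1; ring)⟩
    · obtain ⟨p, hp, hf, hb⟩ := this ⟨h2, h0, h1, h02.symm, h12.symm, h01⟩ H
      exact ⟨p, hp, hf, hb.trans_eq (by unfold Fna; congr 1; ring)⟩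
  wlog hl1 : l1 = -(1 + 1 / l0) generalizing l1 l2
  · obtain ⟨h0, h1, h2, h01, h02, h12⟩ := h
    have hp : 0 < l0 := by linarith
    have e1 := (fn_eq_zero_cases hp h0 h1 h01).resolve_left hl1
    have e2 := (fn_eq_zero_cases hp h0 h2 h02).resolve_right (fun e => h12 (e1.trans e.symm))
    obtain ⟨p, hp, hf, hb⟩ := this ⟨h0, h2, h1, h02, h01, h12.symm⟩ e2
    exact ⟨p, hp, hf, hb.trans_eq (by unfold Fna; congr 1; ring)⟩
  obtain ⟨h0, h1, h2, h01, h02, h12⟩ := h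
  have hp : 0 < l0 := by linarith
  have hl2 := (fn_eq_zero_cases hp h0 h2 h02).resolve_left (fun e => h12 (hl1.trans e.symm))
  refine ⟨l0, hl, h0, ?_⟩
  have hc' : |(c : ℝ)| = 1 := by rcases hc with rfl | rfl <;> simp
  have big : ∀ t : ℝ, |t| - 1 ≤ |1 - c * t| := fun t => by
    have := abs_sub_abs_le_abs_sub ((c : ℝ) * t) 1
    rwa [abs_mul, hc', one_mul, abs_one, abs_sub_comm] at this
  have small : ∀ t : ℝ, 1 - |t| ≤ |1 - c * t| := fun t => by
    have := abs_sub_abs_le_abs_sub 1 ((c : ℝ) * t)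
    rwa [abs_mul, hc', one_mul, abs_one] at this
  have a0 : |l0 ^ k| = l0 ^ k := abs_of_pos (by positivity)
  have a1 : |l1 ^ k| = (1 + 1 / l0) ^ k := by
    rw [abs_pow, hl1, abs_neg, abs_of_pos (by positivity)]
  have a2 : |l2 ^ k| = (1 / (1 + l0)) ^ k := by
    rw [abs_pow, hl2, abs_neg, abs_of_pos (by positivity)]
  have hF : Fna k l0 l1 l2 x ((c * x : ℤ) : ℝ) =
      x ^ 3 * ((1 - c * l0 ^ k) * (1 - c * l1 ^ k) * (1 - c * l2 ^ k)) := by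
    unfold Fna
    simp only [zpow_natCast]
    push_cast
    ring
  have b1 : (1 : ℝ) ≤ (1 + 1 / l0) ^ k := one_le_pow₀ (by
    have : 0 < 1 / l0 := by positivity
    linarith)
  have b2 : (1 / (1 + l0)) ^ k ≤ 1 := pow_le_one₀ (by positivity) (by
    rw [div_le_one (by positivity)]; linarith)
  rw [hF, abs_mul, abs_mul, abs_mul, abs_pow]
  have c0 := big (l0 ^ k)
  have c1 := big (l1 ^ k)
  have c2 := small (l2 ^ k)
  rw [a0] at c0
  rw [a1] at c1
  rw [a2] at c2
  have := sub_nonneg.2 b1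
  have := sub_nonneg.2 b2
  gcongr

/-- The three factors together dominate `a * n ^ (a - 1) / 8`, with `a = k + 1`. -/
theorem succ_mul_pow_le_prod {m p : ℝ} (hm : 0 ≤ m) (hmp : m ≤ p) (hp : 9 / 7 ≤ p) (k : ℕ) :
    1 / 8 * (k + 1) * m ^ k ≤
      (p ^ (k + 1) - 1) * ((1 + 1 / p) ^ (k + 1) - 1) * (1 - (1 / (1 + p)) ^ (k + 1)) := by
  have hp0 : 0 < p := by linarith
  have h1 : (p - 1) * m ^ k ≤ p ^ (k + 1) - 1 := by
    have e : m ^ k ≤ p ^ k := by gcongr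
    have e' : 1 ≤ p ^ k := one_le_pow₀ (by linarith)
    rw [pow_succ]
    nlinarith [mul_le_mul_of_nonneg_left e (by linarith : 0 ≤ p - 1)]
  have h2 : (k + 1) * (1 / p) ≤ (1 + 1 / p) ^ (k + 1) - 1 := by
    have := one_add_mul_le_pow (a := 1 / p) (by
      have : 0 < 1 / p := by positivity
      linarith) (k + 1)
    push_cast at this
    linarith
  have h3 : p / (1 + p) ≤ 1 - (1 / (1 + p)) ^ (k + 1) := by
    have : (1 / (1 + p)) ^ (k + 1) ≤ 1 / (1 + p) := pow_le_of_le_one (by positivity) (by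
      rw [div_le_one (by positivity)]; linarith) (by omega)
    have e : p / (1 + p) = 1 - 1 / (1 + p) := by field_simp; ring
    linarith
  have hp1 : 0 ≤ p - 1 := by linarith
  have hmk : 0 ≤ m ^ k := by positivity
  have h8 : 1 / 8 ≤ (p - 1) / (1 + p) := by
    rw [div_le_div_iff₀ (by norm_num) (by positivity)]; linarith
  calc 1 / 8 * (k + 1) * m ^ k ≤ (p - 1) / (1 + p) * (k + 1) * m ^ k := by gcongr
    _ = ((p - 1) * m ^ k) * ((k + 1) * (1 / p)) * (p / (1 + p)) := by field_simp
    _ ≤ _ := by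
      have n1 : 0 ≤ (k + 1) * (1 / p) := by positivity
      have n0 : 0 ≤ (p - 1) * m ^ k := by positivity
      have n3 : 0 ≤ p / (1 + p) := by positivity
      exact mul_le_mul (mul_le_mul h1 h2 n1 (n0.trans h1)) h3 n3
        (mul_nonneg (n0.trans h1) (n1.trans h2))

/-- The three factors together dominate `2 ^ (a - 1)`, with `a = k + 3`. -/
theorem two_pow_le_prod {p : ℝ} (hp : 249 / 200 ≤ p) (hp' : p ≤ 5 / 4) (k : ℕ) :
    (2 : ℝ) ^ (k + 2) ≤
      (p ^ (k + 3) - 1) * ((1 + 1 / p) ^ (k + 3) - 1) * (1 - (1 / (1 + p)) ^ (k + 3)) := by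
  have hp0 : 0 < p := by linarith
  have hq : 9 / 5 ≤ 1 + 1 / p := by
    have : 4 / 5 ≤ 1 / p := by rw [div_le_div_iff₀ (by norm_num) hp0]; linarith
    linarith
  have hr0 : 0 ≤ 1 / (1 + p) := by positivity
  have hr : 1 / (1 + p) ≤ 200 / 449 := by
    rw [div_le_div_iff₀ (by positivity) (by norm_num)]; linarith
  have hpq : p * (1 + 1 / p) = p + 1 := by field_simp
  generalize 1 + 1 / p = q at *
  generalize 1 / (1 + p) = r at *
  have P : ∀ j : ℕ, 0 ≤ p ^ j - 1 := fun j => sub_nonneg.2 (one_le_pow₀ (by linarith))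
  have Q : ∀ j : ℕ, 0 ≤ q ^ j - 1 := fun j => sub_nonneg.2 (one_le_pow₀ (by linarith))
  have R : ∀ j : ℕ, 0 ≤ 1 - r ^ j := fun j => sub_nonneg.2 (pow_le_one₀ hr0 (by linarith))
  induction k with
  | zero =>
    have e1 : (249 / 200 : ℝ) ^ 3 - 1 ≤ p ^ 3 - 1 := by gcongr
    have e2 : (9 / 5 : ℝ) ^ 3 - 1 ≤ q ^ 3 - 1 := by gcongr
    have e3 : 1 - (200 / 449 : ℝ) ^ 3 ≤ 1 - r ^ 3 := by gcongr
    refine le_trans ?_ (mul_le_mul (mul_le_mul e1 e2 (by norm_num) (P 3)) e3 (by norm_num)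
      (mul_nonneg (P 3) (Q 3)))
    norm_num
  | succ k ih =>
    have e1 : p * (p ^ (k + 3) - 1) ≤ p ^ (k + 1 + 3) - 1 := by
      rw [show k + 1 + 3 = (k + 3) + 1 by ring, pow_succ p (k + 3)]; linarith
    have e2 : q * (q ^ (k + 3) - 1) ≤ q ^ (k + 1 + 3) - 1 := by
      rw [show k + 1 + 3 = (k + 3) + 1 by ring, pow_succ q (k + 3)]; linarith
    have e3 : 1 - r ^ (k + 3) ≤ 1 - r ^ (k + 1 + 3) :=
      sub_le_sub_left (pow_le_pow_of_le_one hr0 (by linarith) (by omega)) 1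
    refine le_trans ?_ (mul_le_mul (mul_le_mul e1 e2 (mul_nonneg (by linarith) (Q _)) (P _)) e3
      (R _) (mul_nonneg (P _) (Q _)))
    have e4 : p * (p ^ (k + 3) - 1) * (q * (q ^ (k + 3) - 1)) * (1 - r ^ (k + 3)) =
        (p + 1) * ((p ^ (k + 3) - 1) * (q ^ (k + 3) - 1) * (1 - r ^ (k + 3))) := by
      rw [← hpq]; ring
    rw [e4, show k + 1 + 2 = (k + 2) + 1 by ring, pow_succ, mul_comm]
    exact mul_le_mul (by linarith) ih (by positivity) (by linarith)

theorem stmt17 (x c : ℤ) (hc : c = 1 ∨ c = -1) :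
    (∀ n a : ℤ, 1 ≤ n → 2 ≤ a → ∀ l0 l1 l2 : ℝ, IsRoots n l0 l1 l2 →
      (|(x : ℝ)| ^ 3 / 8) * (a : ℝ) * ((n : ℝ)) ^ (a - 1) ≤
        |Fna a l0 l1 l2 (x : ℝ) ((c * x : ℤ) : ℝ)|) ∧
    (∀ n : ℤ, 0 ≤ n → ∀ l0 l1 l2 : ℝ, IsRoots n l0 l1 l2 →
      Fna 1 l0 l1 l2 (x : ℝ) (x : ℝ) = -(2 * (n : ℝ) + 1) * (x : ℝ) ^ 3) ∧
    (∀ a : ℤ, 3 ≤ a → ∀ l0 l1 l2 : ℝ, IsRoots 0 l0 l1 l2 →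
      |(x : ℝ)| ^ 3 * 2 ^ (a - 1) ≤ |Fna a l0 l1 l2 (x : ℝ) ((c * x : ℤ) : ℝ)|) := by
  refine ⟨fun n a hn ha l0 l1 l2 h => ?_, fun n _ l0 l1 l2 h => ?_, fun a ha l0 l1 l2 h => ?_⟩
  · obtain ⟨k, rfl⟩ : ∃ k : ℕ, a = (k + 1 : ℕ) := ⟨(a - 1).toNat, by omega⟩
    have hn' : (1 : ℝ) ≤ n := by exact_mod_cast hn
    have hM : fn n (max n (9 / 7)) < 0 := by
      unfold fn
      rcases hn.eq_or_lt with rfl | hn2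
      · norm_num
      · have : (2 : ℝ) ≤ n := by exact_mod_cast hn2
        rw [max_eq_left (by linarith)]
        nlinarith
    obtain ⟨p, hp, -, hb⟩ := h.le_abs_Fna hM (le_max_of_le_left hn') (x := x) hc (k + 1)
    have hp' := max_lt_iff.1 hp
    refine le_trans ?_ hb
    have := mul_le_mul_of_nonneg_left
      (succ_mul_pow_le_prod (by linarith) hp'.1.le hp'.2.le k) (by positivity : 0 ≤ |(x : ℝ)| ^ 3)
    refine le_of_eq_of_le ?_ this
    rw [show ((k + 1 : ℕ) : ℤ) - 1 = (k : ℤ) by push_cast; ring, zpow_natCast]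
    push_cast
    ring
  · have h1 := h.fn_eq_prod 1
    unfold fn at h1
    simp only [Fna, zpow_one]
    linear_combination -(x : ℝ) ^ 3 * h1
  · obtain ⟨k, rfl⟩ : ∃ k : ℕ, a = (k + 3 : ℕ) := ⟨(a - 3).toNat, by omega⟩
    have hM : fn 0 (249 / 200) < 0 := by unfold fn; norm_num
    obtain ⟨p, hp, hf, hb⟩ := h.le_abs_Fna hM (by norm_num) (x := x) hc (k + 3)
    have hp' : p ≤ 5 / 4 := by
      by_contra! H
      unfold fn at hf
      push_cast at hf
      nlinarith [mul_pos (sub_pos.2 H) (sub_pos.2 H),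
        mul_pos (mul_pos (sub_pos.2 H) (sub_pos.2 H)) (sub_pos.2 H)]
    refine le_trans ?_ hb
    rw [show ((k + 3 : ℕ) : ℤ) - 1 = ((k + 2 : ℕ) : ℤ) by push_cast; ring, zpow_natCast]
    exact mul_le_mul_of_nonneg_left (two_pow_le_prod hp.le hp' k) (by positivity)
end
end

section
/- Let n ≥ 3 and m ≥ 1 be integers and let λ0 > 0 > λ1 > −1 > λ2 be the real roots of f_n. Let P be a polynomial with integer coefficients such that P(λ0) ≠ 0 and |P(λ0)·P(λ1)·P(λ2)| = m (i.e., the element γ = P(λ0) of ℤ[λ0] has norm ±m). Then there exist integers A, B and a polynomial Q with integer coefficients such that P(λ0) = Q(λ0)·λ0^A·λ2^B and, writing δ_0 = Q(λ0), δ_1 = Q(λ1), δ_2 = Q(λ2), one has m^{1/3}/√(n+3) ≤ |δ_i| ≤ √(n+3)·m^{1/3} for i ∈ {1, 2}, and m^{1/3}/(n+3) ≤ |δ_0| ≤ (n+3)·m^{1/3}. Moreover, if m = 1, then |δ_0| = |δ_1| = |δ_2| = 1. -/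
noncomputable section

/-- `l0 > 0 > l1 > −1 > l2` are the ordered real roots of `f_n`. -/
def IsOrderedRoots (n : ℤ) (l0 l1 l2 : ℝ) : Prop :=
  fn n l0 = 0 ∧ fn n l1 = 0 ∧ fn n l2 = 0 ∧ 0 < l0 ∧ l1 < 0 ∧ -1 < l1 ∧ l2 < -1

section

open Polynomial

/-- Some lattice translate of a point of a triangle lattice is within `2/3` of the side length. -/
lemma exists_int_translate_abs_le (s t : ℝ) : ∃ k l : ℤ, ∀ α β M : ℝ,
    |α| ≤ M → |β| ≤ M → |α - β| ≤ M → |(s - k) * α + (t - l) * β| ≤ 2 / 3 * M := by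
  have key : ∀ s t : ℝ, 0 ≤ s → 0 ≤ t → s + t ≤ 1 → ∃ k l : ℤ, ∀ α β M : ℝ,
      |α| ≤ M → |β| ≤ M → |α - β| ≤ M → |(s - k) * α + (t - l) * β| ≤ 2 / 3 * M := by
    intro s t hs ht hst
    by_cases h1 : 1 / 3 ≤ s
    · refine ⟨1, 0, fun α β M hα hβ hαβ => ?_⟩
      rw [abs_le] at *
      push_cast
      constructor <;> nlinarith
    by_cases h2 : 1 / 3 ≤ t
    · refine ⟨0, 1, fun α β M hα hβ hαβ => ?_⟩
      rw [abs_le] at *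
      push_cast
      constructor <;> nlinarith
    · refine ⟨0, 0, fun α β M hα hβ hαβ => ?_⟩
      rw [abs_le] at *
      push_cast
      constructor <;> nlinarith
  have hs := Int.floor_add_fract s
  have ht := Int.floor_add_fract t
  by_cases h : Int.fract s + Int.fract t ≤ 1
  · obtain ⟨k, l, hkl⟩ := key _ _ (Int.fract_nonneg s) (Int.fract_nonneg t) h
    refine ⟨⌊s⌋ + k, ⌊t⌋ + l, fun α β M hα hβ hαβ => ?_⟩
    convert hkl α β M hα hβ hαβ using 2
    push_cast
    rw [← Int.self_sub_floor, ← Int.self_sub_floor]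
    ring
  · obtain ⟨k, l, hkl⟩ := key (1 - Int.fract s) (1 - Int.fract t)
      (by linarith [Int.fract_lt_one s]) (by linarith [Int.fract_lt_one t]) (by linarith)
    refine ⟨⌊s⌋ + 1 - k, ⌊t⌋ + 1 - l, fun α β M hα hβ hαβ => ?_⟩
    rw [← abs_neg]
    convert hkl α β M hα hβ hαβ using 2
    push_cast
    rw [← Int.self_sub_floor, ← Int.self_sub_floor]
    ring

lemma exists_real_coords {a b c : ℝ} (ha : 0 < a) (hc : 0 < c) (x y : ℝ) :
    ∃ s t : ℝ, x = s * a + t * b ∧ y = -(s * b) + t * c := by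
  have hD : a * c + b ^ 2 ≠ 0 := by positivity
  refine ⟨(c * x - b * y) / (a * c + b ^ 2), (b * x + a * y) / (a * c + b ^ 2), ?_, ?_⟩ <;>
  · field_simp
    ring

/-- `|(u - v)(u - w)(v - w)|` is at most `2u²|v|` when `|w| ≤ |v| ≤ |u|`. -/
lemma abs_vandermonde_le {u v w : ℝ} (hu : u ≠ 0) (hv : v ≠ 0) (hvu : |v| ≤ |u|)
    (hwv : |w| ≤ |v|) : |(u - v) * (u - w) * (v - w)| ≤ 2 * (u ^ 2 * |v|) := by
  obtain ⟨x, rfl⟩ : ∃ x, v = u * x := ⟨v / u, by field_simp⟩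
  obtain ⟨y, rfl⟩ : ∃ y, w = u * x * y := ⟨w / (u * x), (mul_div_cancel₀ w hv).symm⟩
  have hx : |x| ≤ 1 := by
    rw [abs_mul] at hvu
    exact le_of_mul_le_mul_left (by linarith) (abs_pos.2 hu)
  have hy : |y| ≤ 1 := by
    rw [abs_mul (u * x)] at hwv
    exact le_of_mul_le_mul_left (by linarith) (abs_pos.2 hv)
  have hxy : |x * y| ≤ 1 := by
    rw [abs_mul]
    exact mul_le_one₀ hx (abs_nonneg _) hy
  have h : (u - u * x) * (u - u * x * y) * (u * x - u * x * y) =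
      (u ^ 2 * (u * x)) * ((1 - x) * (1 - y) * (1 - x * y)) := by ring
  rw [abs_le] at hx hy hxy
  have h0 : 0 ≤ (1 - x) * (1 - y) * (1 - x * y) :=
    mul_nonneg (mul_nonneg (by linarith) (by linarith)) (by linarith)
  have h2 : (1 - x) * (1 - y) * (1 - x * y) ≤ 2 := by
    have h3 : (1 - x) * (1 - y) ≤ 2 * (1 + x * y) := by nlinarith
    nlinarith [sq_nonneg (x * y)]
  rw [h, abs_mul, abs_of_nonneg h0, abs_mul, abs_of_nonneg (sq_nonneg u)]
  nlinarith [mul_nonneg (sq_nonneg u) (abs_nonneg (u * x))]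

lemma abs_vandermonde_le_of_sorted {u v w R : ℝ} (h1 : |u| * |v| * |w| = 1)
    (hvu : |v| ≤ |u|) (hwv : |w| ≤ |v|) (hR : |u| ≤ R * |w|) :
    |(u - v) * (u - w) * (v - w)| ≤ 2 * R := by
  have hu : u ≠ 0 := by rintro rfl; simp at h1
  have hv : v ≠ 0 := by rintro rfl; simp at h1
  refine (abs_vandermonde_le hu hv hvu hwv).trans ?_
  have : u ^ 2 * |v| = |u| * (|u| * |v|) := by rw [← sq_abs u]; ring
  rw [this]
  have h3 : |u| * (|u| * |v|) ≤ R * |w| * (|u| * |v|) := by gcongr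
  have h4 : R * |w| * (|u| * |v|) = R := by linear_combination R * h1
  linarith

/-- Three reals of product `±1` whose ratios are at most `R` have discriminant at most `(2R)²`. -/
lemma abs_vandermonde_le_of_ratio {R : ℝ} {d : Fin 3 → ℝ} (h1 : |d 0| * |d 1| * |d 2| = 1)
    (hR : ∀ i j, |d i| ≤ R * |d j|) :
    |(d 0 - d 1) * (d 0 - d 2) * (d 1 - d 2)| ≤ 2 * R := by
  have perm : ∀ i j k, |d i| * |d j| * |d k| = 1 → |d j| ≤ |d i| → |d k| ≤ |d j| →
      |d i - d j| * |d i - d k| * |d j - d k| ≤ 2 * R := fun i j k h hji hkj => by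
    simpa only [abs_mul] using abs_vandermonde_le_of_sorted h hji hkj (hR i k)
  rw [abs_mul, abs_mul]
  have e1 := abs_sub_comm (d 0) (d 1)
  have e2 := abs_sub_comm (d 0) (d 2)
  have e3 := abs_sub_comm (d 1) (d 2)
  rcases le_total |d 0| |d 1| with h01 | h01 <;> rcases le_total |d 0| |d 2| with h02 | h02 <;>
    rcases le_total |d 1| |d 2| with h12 | h12
  · rw [e1, e2, e3]; linarith [perm 2 1 0 (by linarith) h12 h01]
  · rw [e1, e2]; linarith [perm 1 2 0 (by linarith) h12 h02]
  · rw [e1]; linarith [perm 1 0 2 (by linarith) h01 h02]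
  · rw [e1]; linarith [perm 1 0 2 (by linarith) h01 h02]
  · rw [e2, e3]; linarith [perm 2 0 1 (by linarith) h02 h01]
  · rw [e2, e3]; linarith [perm 2 0 1 (by linarith) h02 h01]
  · rw [e3]; linarith [perm 0 2 1 (by linarith) h02 h12]
  · linarith [perm 0 1 2 h1 h01 h12]

/-- The polynomial `f_n` over `ℤ`. -/
def fnPoly (n : ℤ) : ℤ[X] := X ^ 3 - C (n - 1) * X ^ 2 - C (n + 2) * X - 1

lemma fnPoly_monic (n : ℤ) : (fnPoly n).Monic := by
  unfold fnPoly
  monicity!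

lemma fnPoly_natDegree (n : ℤ) : (fnPoly n).natDegree = 3 := by
  unfold fnPoly
  compute_degree!

lemma aeval_fnPoly (n : ℤ) (x : ℝ) : aeval x (fnPoly n) = fn n x := by
  have h2 : aeval x (2 : ℤ[X]) = 2 := map_ofNat _ 2
  simp [fnPoly, fn, h2]

/-- The values of an integral polynomial at the roots of `f_n` are given by a quadratic one. -/
lemma exists_quadratic (n : ℤ) (Q : ℤ[X]) :
    ∃ α β η : ℤ, ∀ x : ℝ, fn n x = 0 → aeval x Q = α + β * x + η * x ^ 2 := by
  refine ⟨(Q %ₘ fnPoly n).coeff 0, (Q %ₘ fnPoly n).coeff 1, (Q %ₘ fnPoly n).coeff 2,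
    fun x hx => ?_⟩
  have hdeg : (Q %ₘ fnPoly n).natDegree < 3 := by
    rw [← fnPoly_natDegree n]
    refine natDegree_modByMonic_lt Q (fnPoly_monic n) fun h => ?_
    simpa [h] using fnPoly_natDegree n
  have h := congrArg (aeval x) (modByMonic_add_div Q (fnPoly n))
  rw [map_add, map_mul, aeval_fnPoly, hx, zero_mul, add_zero, aeval_eq_sum_range' hdeg] at h
  rw [← h]
  simp [Finset.sum_range_succ]

/-- `f_n` has no rational root, in homogeneous form. -/
lemma fn_no_rational_root {n p q : ℤ} {x : ℝ} (hx : fn n x = 0) (h : (p : ℝ) = q * x) :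
    q = 0 := by
  by_contra hq
  have hq' : (q : ℝ) ≠ 0 := by exact_mod_cast hq
  have hr : aeval ((p : ℚ) / q) (fnPoly n) = 0 := by
    have h1 : (((p : ℚ) / q : ℚ) : ℝ) = x := by
      push_cast
      rw [h]
      field_simp
    rw [← h1] at hx
    simp only [fn] at hx
    refine Rat.cast_injective (α := ℝ) ?_
    simp only [fnPoly, map_sub, map_mul, map_pow, aeval_X, aeval_C, map_one]
    simp only [algebraMap_int_eq, eq_intCast]
    push_cast at hx ⊢
    linear_combination hx
  obtain ⟨k, hk⟩ := isInteger_of_is_root_of_monic (fnPoly_monic n) hr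
  rw [← hk] at hr
  simp only [fnPoly, map_sub, map_mul, map_pow, aeval_X, aeval_C, map_one] at hr
  simp only [algebraMap_int_eq, eq_intCast] at hr
  have hr' : k ^ 3 - (n - 1) * k ^ 2 - (n + 2) * k - 1 = 0 := by exact_mod_cast hr
  have h2 := congrArg (fun z : ℤ => (z : ZMod 2)) hr'
  push_cast at h2
  generalize (k : ZMod 2) = k at h2
  generalize (n : ZMod 2) = n at h2
  revert k n
  decide

namespace IsOrderedRoots

variable {n : ℤ} {l0 l1 l2 : ℝ}

lemma fn_eq_mul (h : IsOrderedRoots n l0 l1 l2) (x : ℝ) :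
    fn n x = (x - l0) * (x - l1) * (x - l2) := by
  obtain ⟨h0, h1, h2, hl0, hl1, hl1', hl2⟩ := h
  unfold fn at *
  have h01 : l0 ^ 2 + l0 * l1 + l1 ^ 2 - (n - 1) * (l0 + l1) - (n + 2) = 0 := by
    refine mul_left_cancel₀ (sub_ne_zero.2 (by linarith : l0 ≠ l1)) ?_
    linear_combination h0 - h1
  have h02 : l0 ^ 2 + l0 * l2 + l2 ^ 2 - (n - 1) * (l0 + l2) - (n + 2) = 0 := by
    refine mul_left_cancel₀ (sub_ne_zero.2 (by linarith : l0 ≠ l2)) ?_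
    linear_combination h0 - h2
  have hsum : l0 + l1 + l2 - (n - 1) = 0 := by
    refine mul_left_cancel₀ (sub_ne_zero.2 (by linarith : l1 ≠ l2)) ?_
    linear_combination h01 - h02
  linear_combination (x ^ 2 - l0 ^ 2 - (x - l0) * (l0 + l1)) * hsum + (x - l0) * h01 + h0

lemma l1_eq (h : IsOrderedRoots n l0 l1 l2) : l1 = -1 / (1 + l0) := by
  have hf := h.fn_eq_mul (-1 / (1 + l0))
  obtain ⟨h0, h1, h2, hl0, hl1, hl1', hl2⟩ := h
  have hneg : -1 / (1 + l0) < 0 := div_neg_of_neg_of_pos (by norm_num) (by linarith)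
  have hgt : -1 < -1 / (1 + l0) := by rw [lt_div_iff₀ (by linarith)]; linarith
  have hz : fn n (-1 / (1 + l0)) = 0 := by
    have : 1 + l0 ≠ 0 := by linarith
    unfold fn at *
    field_simp
    linear_combination -h0
  rw [hz] at hf
  rcases mul_eq_zero.1 hf.symm with hf | hf
  · rcases mul_eq_zero.1 hf with hf | hf <;> linarith
  · linarith

lemma l2_eq (h : IsOrderedRoots n l0 l1 l2) : l2 = -(1 + l0) / l0 := by
  have hf := h.fn_eq_mul (-(1 + l0) / l0)
  obtain ⟨h0, h1, h2, hl0, hl1, hl1', hl2⟩ := h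
  have hlt : -(1 + l0) / l0 < -1 := by rw [div_lt_iff₀ (by linarith)]; linarith
  have hz : fn n (-(1 + l0) / l0) = 0 := by
    unfold fn at *
    field_simp
    linear_combination h0
  rw [hz] at hf
  rcases mul_eq_zero.1 hf.symm with hf | hf
  · rcases mul_eq_zero.1 hf with hf | hf <;> linarith
  · linarith

lemma n_mul_eq (h : IsOrderedRoots n l0 l1 l2) :
    n * (l0 * (l0 + 1)) = l0 ^ 3 + l0 ^ 2 - 2 * l0 - 1 := by
  have h0 := h.1
  unfold fn at h0
  linear_combination -h0

lemma n_lt_l0 (h : IsOrderedRoots n l0 l1 l2) : n < l0 := by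
  have h0 := h.n_mul_eq
  have hl0 : 0 < l0 := h.2.2.2.1
  by_contra! hle
  nlinarith [mul_le_mul_of_nonneg_right hle (by positivity : 0 ≤ l0 * (l0 + 1))]

lemma l0_lt (h : IsOrderedRoots n l0 l1 l2) (hn : 3 ≤ n) : l0 < n + 1 := by
  have h0 := h.n_mul_eq
  have hn' : (3 : ℝ) ≤ n := by exact_mod_cast hn
  have hl0 : 3 < l0 := hn'.trans_lt h.n_lt_l0
  by_contra! hle
  nlinarith [mul_le_mul_of_nonneg_right hle (by positivity : 0 ≤ l0 * (l0 + 1))]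

/-- The square root of the discriminant of `f_n` is `n² + n + 7`. -/
lemma vandermonde_eq (h : IsOrderedRoots n l0 l1 l2) :
    (l0 - l1) * (l0 - l2) * (l1 - l2) = n ^ 2 + n + 7 := by
  have h0 := h.n_mul_eq
  have hl0 : 0 < l0 := h.2.2.2.1
  have hn : (n : ℝ) = (l0 ^ 3 + l0 ^ 2 - 2 * l0 - 1) / (l0 * (l0 + 1)) := by
    rw [eq_div_iff (by positivity), h0]
  have h1 : 1 + l0 ≠ 0 := by linarith
  have h1' : l0 + 1 ≠ 0 := by linarith
  rw [hn, h.l1_eq, h.l2_eq]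
  field_simp
  ring

/-- Every `λ₀ᴬλ₂ᴮ`, together with its conjugates, is given by an integral polynomial. -/
lemma exists_unit_poly (h : IsOrderedRoots n l0 l1 l2) (A B : ℤ) :
    ∃ U : ℤ[X], aeval l0 U = l0 ^ A * l2 ^ B ∧ aeval l1 U = l1 ^ A * l0 ^ B ∧
      aeval l2 U = l2 ^ A * l1 ^ B := by
  have e1 := h.l1_eq
  have e2 := h.l2_eq
  obtain ⟨h0, h1, h2, hl0, hl1, hl1', hl2⟩ := h
  have z1 : 1 + l0 ≠ 0 := by linarith
  have z2 : 1 + l1 ≠ 0 := by linarith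
  have z3 : 1 + l2 ≠ 0 := by linarith
  have inv : ∀ x, x ≠ 0 → fn n x = 0 →
      aeval x (X ^ 2 - C (n - 1) * X - C (n + 2) : ℤ[X]) = x⁻¹ := by
    intro x hx hf
    refine eq_inv_of_mul_eq_one_left ?_
    have h2 : aeval x (2 : ℤ[X]) = 2 := map_ofNat _ 2
    simp [fn, h2] at hf ⊢
    linear_combination hf
  have conj : ∀ x, 1 + x ≠ 0 → fn n x = 0 →
      aeval x (X ^ 2 - C n * X - 2 : ℤ[X]) = -1 / (1 + x) := by
    intro x hx hf
    rw [eq_div_iff hx]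
    have h2 : aeval x (2 : ℤ[X]) = 2 := map_ofNat _ 2
    simp [fn, h2] at hf ⊢
    linear_combination hf
  have c0 : -1 / (1 + l0) = l1 := e1.symm
  have c1 : -1 / (1 + l1) = l2 := by
    have h1 : 1 + l1 = l0 / (1 + l0) := by rw [e1]; field_simp; ring
    rw [e2, h1]
    field_simp
  have c2 : -1 / (1 + l2) = l0 := by rw [e2] at z3 ⊢; field_simp; ring
  have pow : ∀ (V W : ℤ[X]) (A : ℤ), ∃ U : ℤ[X], ∀ x : ℝ, aeval x W = (aeval x V)⁻¹ →
      aeval x U = aeval x V ^ A := by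
    intro V W A
    obtain ⟨k, rfl | rfl⟩ := A.eq_nat_or_neg
    · exact ⟨V ^ k, fun x hx => by simp⟩
    · exact ⟨W ^ k, fun x hx => by simp [hx]⟩
  obtain ⟨U, hU⟩ := pow X (X ^ 2 - C (n - 1) * X - C (n + 2)) A
  obtain ⟨V, hV⟩ := pow (-1 - (X ^ 2 - C (n - 1) * X - C (n + 2)))
    (-(1 + (X ^ 2 - C n * X - 2))) B
  have val : ∀ x y, x ≠ 0 → fn n x = 0 → 1 + x ≠ 0 → 1 + y ≠ 0 → -1 / (1 + y) = x →
      aeval x (U * V) = x ^ A * (-1 - x⁻¹) ^ B := by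
    intro x y hx hf hx1 hy1 hy
    rw [map_mul, hU x (by rw [inv x hx hf, aeval_X]), hV x ?_, map_sub, map_neg, map_one,
      inv x hx hf, aeval_X]
    have hx' : -1 - x⁻¹ = -((1 + x) / x) := by field_simp; ring
    rw [map_neg, map_add, conj x hx1 hf, map_sub, inv x hx hf, map_neg, map_one, hx']
    field_simp
    ring
  have i0 : -1 - l0⁻¹ = l2 := by rw [e2]; field_simp; ring
  have i1 : -1 - l1⁻¹ = l0 := by rw [e1]; field_simp; ring
  have i2 : -1 - l2⁻¹ = l1 := by rw [← c1]; field_simp; ring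
  refine ⟨U * V, ?_, ?_, ?_⟩
  · rw [val l0 l2 (by linarith) h0 z1 z3 c2, i0]
  · rw [val l1 l0 (by linarith) h1 z2 z1 c0, i1]
  · rw [val l2 l1 (by linarith) h2 z3 z2 c1, i2]

/-- An integral polynomial taking values of product `±1` at the roots of `f_n` and of small
ratios is `±1` at these roots. -/
lemma abs_eq_one_of_ratio (h : IsOrderedRoots n l0 l1 l2) (Q : ℤ[X])
    (hQ : |aeval l0 Q| * |aeval l1 Q| * |aeval l2 Q| = 1) {R : ℝ}
    (hR : ∀ i j, |![aeval l0 Q, aeval l1 Q, aeval l2 Q] i| ≤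
      R * |![aeval l0 Q, aeval l1 Q, aeval l2 Q] j|)
    (hRn : 2 * R < n ^ 2 + n + 7) :
    |aeval l0 Q| = 1 ∧ |aeval l1 Q| = 1 ∧ |aeval l2 Q| = 1 := by
  have hv := h.vandermonde_eq
  have hfac := h.fn_eq_mul
  obtain ⟨α, β, η, hq⟩ := exists_quadratic n Q
  obtain ⟨h0, h1, h2, hl0, hl1, hl1', hl2⟩ := h
  have hb := abs_vandermonde_le_of_ratio (d := ![aeval l0 Q, aeval l1 Q, aeval l2 Q]) hQ hR
  simp only [Matrix.cons_val] at hb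
  set D : ℤ := (β + η * (n - 1)) ^ 3 - (n - 1) * (β + η * (n - 1)) ^ 2 * η
    - (n + 2) * (β + η * (n - 1)) * η ^ 2 - η ^ 3 with hD
  have e0 := hfac 0
  have e1 := hfac 1
  have em := hfac (-1)
  unfold fn at e0 e1 em
  have s1 : l0 + l1 + l2 = n - 1 := by linarith
  have s2 : l0 * l1 + l0 * l2 + l1 * l2 = -(n + 2) := by linarith
  have s3 : l0 * l1 * l2 = 1 := by linarith
  have hfactor : ((β + η * (n - 1) : ℝ) - η * l2) * ((β + η * (n - 1) : ℝ) - η * l1) *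
      ((β + η * (n - 1) : ℝ) - η * l0) = D := by
    rw [hD]
    push_cast
    linear_combination -((β + η * (n - 1) : ℝ) ^ 2 * η) * s1 + (β + η * (n - 1) : ℝ) * η ^ 2 * s2
      - η ^ 3 * s3
  have hprod : (aeval l0 Q - aeval l1 Q) * (aeval l0 Q - aeval l2 Q) *
      (aeval l1 Q - aeval l2 Q) = D * (n ^ 2 + n + 7) := by
    rw [← hv, ← hfactor, ← s1, hq l0 h0, hq l1 h1, hq l2 h2]
    ring
  have hnpos : (0 : ℝ) < n ^ 2 + n + 7 := by nlinarith [sq_nonneg ((n : ℝ) + 1 / 2)]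
  have hD0 : D = 0 := by
    by_contra hne
    have h1D : (1 : ℝ) ≤ |(D : ℝ)| := by exact_mod_cast Int.one_le_abs hne
    rw [hprod, abs_mul, abs_of_pos hnpos] at hb
    nlinarith
  have hη : η = 0 := by
    rw [hD0, Int.cast_zero] at hfactor
    have key : ∀ x, fn n x = 0 → (β + η * (n - 1) : ℝ) - η * x = 0 → η = 0 := by
      intro x hx hz
      refine fn_no_rational_root (p := β + η * (n - 1)) hx ?_
      push_cast
      linarith
    rcases mul_eq_zero.1 hfactor with hz | hz
    · rcases mul_eq_zero.1 hz with hz | hz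
      · exact key l2 h2 hz
      · exact key l1 h1 hz
    · exact key l0 h0 hz
  have hβ : β = 0 := by
    rw [hD, hη] at hD0
    simpa using hD0
  rw [hη, hβ] at hq
  simp only [Int.cast_zero, zero_mul, add_zero] at hq
  rw [hq l0 h0, hq l1 h1, hq l2 h2] at hQ ⊢
  have h3 : |(α : ℝ)| ^ 3 = 1 := by rw [← hQ]; ring
  have h4 := (pow_eq_one_iff_of_nonneg (abs_nonneg _) (by norm_num)).1 h3
  exact ⟨h4, h4, h4⟩

end IsOrderedRoots

/-- Rewriting the estimate `|log |d| - (log m) / 3| ≤ r log N` multiplicatively. -/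
lemma rpow_bounds_of_log {m N r d : ℝ} (hm : 0 < m) (hN : 0 < N) (hd : d ≠ 0)
    (h : |Real.log |d| - Real.log m / 3| ≤ r * Real.log N) :
    m ^ ((1 : ℝ) / 3) / N ^ r ≤ |d| ∧ |d| ≤ N ^ r * m ^ ((1 : ℝ) / 3) := by
  rw [abs_le] at h
  rw [Real.rpow_def_of_pos hm, Real.rpow_def_of_pos hN, ← Real.exp_sub, ← Real.exp_add,
    ← Real.le_log_iff_exp_le (abs_pos.2 hd), ← Real.log_le_iff_le_exp (abs_pos.2 hd)]
  constructor <;> linarith [h.1, h.2]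

end

open Polynomial in
theorem stmt19 (n m : ℤ) (hn : 3 ≤ n) (hm : 1 ≤ m) (l0 l1 l2 : ℝ)
    (hroots : IsOrderedRoots n l0 l1 l2)
    (P : Polynomial ℤ) (hP0 : aeval l0 P ≠ 0)
    (hPnorm : |aeval l0 P * aeval l1 P * aeval l2 P| = (m : ℝ)) :
    ∃ (A B : ℤ) (Q : Polynomial ℤ),
      aeval l0 P = aeval l0 Q * l0 ^ A * l2 ^ B ∧
      ((m : ℝ) ^ ((1 : ℝ) / 3) / Real.sqrt ((n : ℝ) + 3) ≤ |aeval l1 Q| ∧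
        |aeval l1 Q| ≤ Real.sqrt ((n : ℝ) + 3) * (m : ℝ) ^ ((1 : ℝ) / 3)) ∧
      ((m : ℝ) ^ ((1 : ℝ) / 3) / Real.sqrt ((n : ℝ) + 3) ≤ |aeval l2 Q| ∧
        |aeval l2 Q| ≤ Real.sqrt ((n : ℝ) + 3) * (m : ℝ) ^ ((1 : ℝ) / 3)) ∧
      ((m : ℝ) ^ ((1 : ℝ) / 3) / ((n : ℝ) + 3) ≤ |aeval l0 Q| ∧
        |aeval l0 Q| ≤ ((n : ℝ) + 3) * (m : ℝ) ^ ((1 : ℝ) / 3)) ∧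
      (m = 1 → |aeval l0 Q| = 1 ∧ |aeval l1 Q| = 1 ∧ |aeval l2 Q| = 1) := by
  have e1 := hroots.l1_eq
  have e2 := hroots.l2_eq
  have hnl := hroots.n_lt_l0
  have hln := hroots.l0_lt hn
  have hnm := hroots.n_mul_eq
  have hl0 : 0 < l0 := hroots.2.2.2.1
  have hl1 : l1 < 0 := hroots.2.2.2.2.1
  have hl2 : l2 < 0 := hroots.2.2.2.2.2.2.trans (by norm_num)
  have hn' : (3 : ℝ) ≤ n := by exact_mod_cast hn
  have hm0 : (0 : ℝ) < m := by exact_mod_cast hm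
  set a := Real.log (1 + l0) with ha
  set c := Real.log l0 with hc
  set b := a - c with hb
  have logl1 : Real.log l1 = -a := by
    rw [e1, neg_div, Real.log_neg_eq_log, one_div, Real.log_inv]
  have logl2 : Real.log l2 = b := by
    rw [e2, neg_div, Real.log_neg_eq_log, Real.log_div (by linarith) (by linarith)]
  have ha0 : 0 < a := Real.log_pos (by linarith)
  have hc0 : 0 < c := Real.log_pos (by linarith)
  have hb0 : 0 < b := sub_pos.2 (Real.log_lt_log hl0 (by linarith))
  have hbc : b ≤ c := by
    have : a ≤ c + c := by
      rw [ha, hc, ← Real.log_mul (by linarith) (by linarith)]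
      exact Real.log_le_log (by linarith) (by nlinarith)
    linarith
  have hab : a + b ≤ Real.log (n + 3) := by
    have : a + a ≤ Real.log (n + 3) + c := by
      rw [ha, hc, ← Real.log_mul (by linarith) (by linarith),
        ← Real.log_mul (by linarith) (by linarith)]
      refine Real.log_le_log (by positivity) ?_
      refine le_of_mul_le_mul_right ?_ (by linarith : 0 < l0 + 1)
      nlinarith
    linarith
  have hP : (aeval l0 P ≠ 0 ∧ aeval l1 P ≠ 0) ∧ aeval l2 P ≠ 0 := by
    rw [← mul_ne_zero_iff, ← mul_ne_zero_iff, ← abs_pos, hPnorm]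
    exact hm0
  obtain ⟨⟨-, hP1⟩, hP2⟩ := hP
  set x0 := Real.log (aeval l0 P) - Real.log m / 3 with hx0
  set x1 := Real.log (aeval l1 P) - Real.log m / 3 with hx1
  set x2 := Real.log (aeval l2 P) - Real.log m / 3 with hx2
  have hsum : x0 + x1 + x2 = 0 := by
    have := congrArg Real.log hPnorm
    rw [Real.log_abs, Real.log_mul (mul_ne_zero hP0 hP1) hP2, Real.log_mul hP0 hP1] at this
    linarith
  have reduce : ∀ k l : ℤ, ∃ (A B : ℤ) (Q : ℤ[X]),
      aeval l0 P = aeval l0 Q * l0 ^ A * l2 ^ B ∧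
      aeval l0 Q ≠ 0 ∧ aeval l1 Q ≠ 0 ∧ aeval l2 Q ≠ 0 ∧
      Real.log |aeval l0 Q| - Real.log m / 3 = x0 + k * c + l * a ∧
      Real.log |aeval l1 Q| - Real.log m / 3 = x1 - k * a - l * b ∧
      Real.log |aeval l2 Q| - Real.log m / 3 = x2 + k * b - l * c := by
    intro k l
    obtain ⟨U, hU0, hU1, hU2⟩ := hroots.exists_unit_poly (k + l) l
    have v0 := zpow_ne_zero (k + l) hl0.ne'
    have v1 := zpow_ne_zero (k + l) hl1.ne
    have v2 := zpow_ne_zero (k + l) hl2.ne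
    have w0 := zpow_ne_zero l hl0.ne'
    have w1 := zpow_ne_zero l hl1.ne
    have w2 := zpow_ne_zero l hl2.ne
    refine ⟨-(k + l), -l, P * U, ?_, ?_, ?_, ?_, ?_, ?_, ?_⟩
    · rw [map_mul, hU0, zpow_neg, zpow_neg]
      field_simp
    · rw [map_mul, hU0]
      exact mul_ne_zero hP0 (mul_ne_zero v0 w2)
    · rw [map_mul, hU1]
      exact mul_ne_zero hP1 (mul_ne_zero v1 w0)
    · rw [map_mul, hU2]
      exact mul_ne_zero hP2 (mul_ne_zero v2 w1)
    · rw [map_mul, hU0, Real.log_abs, Real.log_mul hP0 (mul_ne_zero v0 w2), Real.log_mul v0 w2,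
        Real.log_zpow, Real.log_zpow, logl2]
      push_cast
      linarith
    · rw [map_mul, hU1, Real.log_abs, Real.log_mul hP1 (mul_ne_zero v1 w0), Real.log_mul v1 w0,
        Real.log_zpow, Real.log_zpow, logl1]
      push_cast
      linarith
    · rw [map_mul, hU2, Real.log_abs, Real.log_mul hP2 (mul_ne_zero v2 w1), Real.log_mul v2 w1,
        Real.log_zpow, Real.log_zpow, logl1, logl2]
      push_cast
      linarith
  obtain ⟨s, t, hs, ht⟩ := exists_real_coords (b := b) ha0 hc0 x1 x2
  have hN : (0 : ℝ) < n + 3 := by linarith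
  by_cases hm1 : m = 1
  · obtain ⟨k, l, hkl⟩ := exists_int_translate_abs_le s t
    obtain ⟨A, B, Q, hA, hQ0, hQ1, hQ2, y0, y1, y2⟩ := reduce k l
    simp only [hm1, Int.cast_one, Real.log_one, zero_div, sub_zero] at y0 y1 y2
    set M := a + c with hM
    have habs : |a + c| ≤ M := by rw [abs_of_pos (by linarith)]
    have habs' : |a + b| ≤ M := by rw [abs_of_pos (by linarith)]; linarith
    have habs'' : |c - b| ≤ M := by rw [abs_of_nonneg (by linarith)]; linarith
    have d10 := hkl (a + c) (a + b) M habs habs' (by convert habs'' using 2; ring)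
    have d20 := hkl (c - b) (a + c) M habs'' habs
      (by rw [← abs_neg]; convert habs' using 2; ring)
    have d21 := hkl (-(a + b)) (c - b) M (by rwa [abs_neg]) habs''
      (by rw [← abs_neg]; convert habs using 2; ring)
    set R := Real.exp (2 / 3 * M) with hR
    have hR3 : R ^ 3 = (l0 * (1 + l0)) ^ 2 := by
      rw [hR, ← Real.exp_nat_mul, hM, ha, hc,
        ← Real.exp_log (by positivity : 0 < (l0 * (1 + l0)) ^ 2), Real.log_pow,
        Real.log_mul (by linarith) (by linarith)]
      congr 1
      push_cast
      ring
    have hRn : 2 * R < n ^ 2 + n + 7 := by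
      refine lt_of_pow_lt_pow_left₀ 3 (by positivity) ?_
      have h1 : l0 * (1 + l0) < (n + 1) * (n + 2) :=
        mul_lt_mul'' hln (by linarith) hl0.le (by linarith)
      have h2 : (l0 * (1 + l0)) ^ 2 < ((n + 1) * (n + 2)) ^ 2 := by gcongr
      have h3 : 8 * (((n : ℝ) + 1) * (n + 2)) ^ 2 ≤ (n ^ 2 + n + 7) ^ 3 := by
        obtain ⟨u, hu, hnu⟩ : ∃ u : ℝ, 0 ≤ u ∧ (n : ℝ) = u + 3 := ⟨n - 3, by linarith, by ring⟩
        rw [hnu, ← sub_nonneg]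
        ring_nf
        positivity
      rw [mul_pow, hR3]
      linarith
    have ratio : ∀ u v : ℝ, u ≠ 0 → v ≠ 0 → |Real.log |u| - (Real.log |v|)| ≤ 2 / 3 * M →
        |u| ≤ R * |v| := by
      intro u v hu hv huv
      rw [← Real.exp_log (abs_pos.2 hv), hR, ← Real.exp_add,
        ← Real.log_le_iff_le_exp (abs_pos.2 hu)]
      linarith [le_abs_self (Real.log |u| - Real.log |v|)]
    have r10 : |Real.log |aeval l1 Q| - (Real.log |aeval l0 Q|)| ≤ 2 / 3 * M := by
      convert d10 using 2
      rw [y0, y1]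
      linarith
    have r20 : |Real.log |aeval l2 Q| - (Real.log |aeval l0 Q|)| ≤ 2 / 3 * M := by
      convert d20 using 2
      rw [y0, y2]
      linarith
    have r21 : |Real.log |aeval l2 Q| - (Real.log |aeval l1 Q|)| ≤ 2 / 3 * M := by
      convert d21 using 2
      rw [y1, y2]
      linarith
    have hnorm : |aeval l0 Q| * |aeval l1 Q| * |aeval l2 Q| = 1 := by
      rw [← Real.exp_log (abs_pos.2 hQ0), ← Real.exp_log (abs_pos.2 hQ1),
        ← Real.exp_log (abs_pos.2 hQ2), ← Real.exp_add, ← Real.exp_add, Real.exp_eq_one_iff,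
        y0, y1, y2]
      linarith
    have hone := hroots.abs_eq_one_of_ratio Q hnorm (R := R) (fun i j => by
      have hM0 : 0 ≤ 2 / 3 * M := by linarith
      fin_cases i <;> fin_cases j <;> simp <;> apply ratio <;>
        first | assumption | (rw [abs_sub_comm]; assumption) | simpa using hM0) hRn
    have hsq : 1 ≤ Real.sqrt (n + 3) := Real.one_le_sqrt.2 (by linarith)
    refine ⟨A, B, Q, hA, ?_, ?_, ?_, fun _ => hone⟩ <;>
      simp only [hone, hm1, Int.cast_one, Real.one_rpow, mul_one]
    · exact ⟨div_le_one_of_le₀ hsq (by positivity), hsq⟩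
    · exact ⟨div_le_one_of_le₀ hsq (by positivity), hsq⟩
    · exact ⟨div_le_one_of_le₀ (by linarith) hN.le, by linarith⟩
  · obtain ⟨A, B, Q, hA, hQ0, hQ1, hQ2, y0, y1, y2⟩ := reduce (round s) (round t)
    have hround : ∀ α β : ℝ, |(s - round s) * α + (t - round t) * β| ≤
        1 / 2 * |α| + 1 / 2 * |β| := fun α β => by
      refine (abs_add_le _ _).trans ?_
      rw [abs_mul, abs_mul]
      gcongr
      · exact abs_sub_round s
      · exact abs_sub_round t
    have z1 : |x1 - round s * a - round t * b| ≤ 1 / 2 * Real.log (n + 3) := by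
      have := hround a b
      rw [abs_of_pos ha0, abs_of_pos hb0] at this
      rw [hs, show s * a + t * b - round s * a - round t * b =
        (s - round s) * a + (t - round t) * b by ring]
      linarith
    have z2 : |x2 + round s * b - round t * c| ≤ 1 / 2 * Real.log (n + 3) := by
      have := hround (-b) c
      rw [abs_neg, abs_of_pos hb0, abs_of_pos hc0] at this
      rw [ht, show -(s * b) + t * c + round s * b - round t * c =
        (s - round s) * -b + (t - round t) * c by ring]
      linarith
    have z0 : |x0 + round s * c + round t * a| ≤ 1 * Real.log (n + 3) := by
      rw [abs_le] at *
      have hac : a = b + c := by linarith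
      have : x0 + round s * c + round t * a = -(x1 - round s * a - round t * b) -
          (x2 + round s * b - round t * c) := by
        rw [hac]
        linarith
      rw [this]
      constructor <;> linarith [z1.1, z1.2, z2.1, z2.2]
    rw [← y0] at z0
    rw [← y1] at z1
    rw [← y2] at z2
    have b0 := rpow_bounds_of_log hm0 hN hQ0 z0
    have b1 := rpow_bounds_of_log hm0 hN hQ1 z1
    have b2 := rpow_bounds_of_log hm0 hN hQ2 z2
    rw [Real.rpow_one] at b0
    rw [← Real.sqrt_eq_rpow] at b1 b2
    exact ⟨A, B, Q, hA, b1, b2, b0, fun h => absurd h hm1⟩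
end
end
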